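/- arXiv:2508.04844 — 3 statements merged into one kernel-verified Lean document; each statement's English description precedes it below -/
import Mathlib

section
/- Let Γ be a subgroup of SL₂(ℤ), 𝔘 ⊆ ℍ a connected Γ-invariant open subset, k ≥ 0 an integer, and f : 𝔘 → ℂ a holomorphic function with f(γ·z) = j_γ(z)^{k+2}·f(z) for all γ ∈ Γ and z ∈ 𝔘. Then the following are equivalent: (a) there exist holomorphic functions c₀, …, c_k : 𝔘 → ℂ such that F(z,x,y) := Σ_{i=0}^{k} c_i(z)·x^{k−i}·y^{i} is Γ-equivariant and, for every (x,y) ∈ ℂ², the function z ↦ F(z,x,y) is holomorphic on 𝔘 with complex derivative equal to f(z)·(x − z·y)^k; (b) there exists a holomorphic function h : 𝔘 → ℂ with h(γ·z) = j_γ(z)^{−k}·h(z) for all γ ∈ Γ and z ∈ 𝔘 whose (k+1)-st complex derivative equals f. -/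
/- STATEMENT 2: A holomorphic modular form `f` of weight `k + 2` admits a
holomorphic harmonic lift if and only if it is the `(k+1)`-st complex derivative
of a holomorphic modular function of weight `-k`. -/

open Complex ComplexConjugate

noncomputable section

abbrev SL2Z := Matrix.SpecialLinearGroup (Fin 2) ℤ

/-- The real matrix associated to an element of `SL₂(ℤ)`. -/
def toRealM (γ : SL2Z) : Matrix (Fin 2) (Fin 2) ℝ :=
  γ.val.map fun n => (n : ℝ)

/-- Automorphy factor `j_γ(z) = c·z + d` for a real matrix `γ = (a, b; c, d)`. -/
def jFac (γ : Matrix (Fin 2) (Fin 2) ℝ) (z : ℂ) : ℂ :=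
  ((γ 1 0 : ℝ) : ℂ) * z + ((γ 1 1 : ℝ) : ℂ)

/-- Möbius action `γ·z = (a·z + b)/(c·z + d)`. -/
def moeb (γ : Matrix (Fin 2) (Fin 2) ℝ) (z : ℂ) : ℂ :=
  (((γ 0 0 : ℝ) : ℂ) * z + ((γ 0 1 : ℝ) : ℂ)) / (((γ 1 0 : ℝ) : ℂ) * z + ((γ 1 1 : ℝ) : ℂ))

/-- Complex entries of an element of `SL₂(ℤ)`. -/
def entC (γ : SL2Z) (i j : Fin 2) : ℂ := ((toRealM γ i j : ℝ) : ℂ)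

open Polynomial in
/-- Differentiating `P_ζ^{(m)}(ζ)`, where `P_ζ = ∑ cᵢ(ζ) X^(k-i)`. -/
theorem hasDerivAt_eval_iterate_derivative (k m : ℕ) (c : ℕ → ℂ → ℂ) (c' : ℕ → ℂ) (z : ℂ)
    (hc : ∀ i ∈ Finset.range (k + 1), HasDerivAt (c i) (c' i) z) :
    HasDerivAt (fun ζ => (derivative^[m]
        (∑ i ∈ Finset.range (k + 1), C (c i ζ) * X ^ (k - i))).eval ζ)
      ((derivative^[m] (∑ i ∈ Finset.range (k + 1), C (c' i) * X ^ (k - i))).eval z +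
        (derivative^[m + 1] (∑ i ∈ Finset.range (k + 1), C (c i z) * X ^ (k - i))).eval z) z := by
  have key : ∀ (n : ℕ) (a : ℕ → ℂ) (w : ℂ), (derivative^[n]
      (∑ i ∈ Finset.range (k + 1), C (a i) * X ^ (k - i))).eval w =
      ∑ i ∈ Finset.range (k + 1), a i * (derivative^[n] (X ^ (k - i) : ℂ[X])).eval w := by
    intro n a w
    rw [iterate_derivative_sum, eval_finsetSum]
    simp only [iterate_derivative_C_mul, eval_mul, eval_C]
  simp only [key]
  rw [← Finset.sum_add_distrib]
  refine HasDerivAt.fun_sum fun i hi => ?_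
  rw [Function.iterate_succ_apply']
  exact (hc i hi).mul (Polynomial.hasDerivAt _ z)

theorem sum_taylor_eq_sum_coeff (k : ℕ) (a : ℕ → ℂ) (x y z : ℂ) :
    ∑ i ∈ Finset.range (k + 1), (∑ m ∈ Finset.range (k + 1),
        a m * (m.choose (k - i) : ℂ) * (-z) ^ (m - (k - i))) * x ^ (k - i) * y ^ i =
      ∑ m ∈ Finset.range (k + 1), a m * (x - z * y) ^ m * y ^ (k - m) := by
  rw [← Finset.sum_range_reflect]
  simp only [Finset.sum_mul]
  rw [Finset.sum_comm]
  refine Finset.sum_congr rfl fun m hm => ?_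
  have hm' : m ≤ k := Nat.lt_succ_iff.mp (Finset.mem_range.mp hm)
  rw [sub_eq_add_neg, add_pow, Finset.mul_sum, Finset.sum_mul]
  symm
  refine Finset.sum_subset_zero_on_sdiff (Finset.range_subset_range.mpr (by lia)) ?_ ?_
  · intro j hj
    simp only [Finset.mem_sdiff, Finset.mem_range] at hj
    have h1 : k - (k + 1 - 1 - j) = j := by lia
    rw [h1, Nat.choose_eq_zero_of_lt (by lia)]
    simp
  · intro j hj
    have hj' : j ≤ m := Nat.lt_succ_iff.mp (Finset.mem_range.mp hj)
    have h1 : k - (k + 1 - 1 - j) = j := by lia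
    have h2 : k + 1 - 1 - j = (m - j) + (k - m) := by lia
    rw [h1, h2, pow_add, ← neg_mul, mul_pow]
    ring

theorem hasDerivAt_sum_taylor (k : ℕ) (g : ℕ → ℂ → ℂ) (x y z : ℂ)
    (hg : ∀ m ≤ k, HasDerivAt (g m) (g (m + 1) z) z) :
    HasDerivAt (fun ζ => ∑ m ∈ Finset.range (k + 1),
        g m ζ / (m.factorial : ℂ) * (x - ζ * y) ^ m * y ^ (k - m))
      (g (k + 1) z / (k.factorial : ℂ) * (x - z * y) ^ k) z := by
  induction k with
  | zero => simpa using hg 0 le_rfl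
  | succ k ih =>
    have h1 := (ih fun m hm => hg m (by lia)).mul_const y
    have h2 : HasDerivAt (fun ζ : ℂ => x - ζ * y) (-y) z := by
      simpa using ((hasDerivAt_id z).mul_const y).const_sub x
    have h3 := ((hg (k + 1) le_rfl).div_const ((k + 1).factorial : ℂ)).fun_mul (h2.fun_pow (k + 1))
    have hfun : (fun ζ => ∑ m ∈ Finset.range (k + 1 + 1),
        g m ζ / (m.factorial : ℂ) * (x - ζ * y) ^ m * y ^ (k + 1 - m)) =
        fun ζ => (∑ m ∈ Finset.range (k + 1),
          g m ζ / (m.factorial : ℂ) * (x - ζ * y) ^ m * y ^ (k - m)) * y +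
          g (k + 1) ζ / ((k + 1).factorial : ℂ) * (x - ζ * y) ^ (k + 1) := by
      funext ζ
      rw [Finset.sum_range_succ, Finset.sum_mul]
      congr 1
      · refine Finset.sum_congr rfl fun m hm => ?_
        have hm' : m ≤ k := Nat.lt_succ_iff.mp (Finset.mem_range.mp hm)
        rw [Nat.succ_sub hm', pow_succ]
        ring
      · simp
    rw [hfun]
    refine (h1.fun_add h3).congr_deriv ?_
    have hk : (k.factorial : ℂ) ≠ 0 := by exact_mod_cast k.factorial_ne_zero
    have hk1 : (k : ℂ) + 1 ≠ 0 := by exact_mod_cast k.succ_ne_zero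
    rw [Nat.factorial_succ]
    push_cast
    field_simp
    ring

theorem entC_det (γ : SL2Z) : entC γ 0 0 * entC γ 1 1 - entC γ 0 1 * entC γ 1 0 = 1 := by
  have h := γ.det_coe
  rw [Matrix.det_fin_two] at h
  simp only [entC, toRealM, Matrix.map_apply]
  exact_mod_cast h

theorem jFac_eq (γ : SL2Z) (z : ℂ) : jFac (toRealM γ) z = entC γ 1 0 * z + entC γ 1 1 := rfl

theorem jFac_ne_zero (γ : SL2Z) {z : ℂ} (hz : 0 < z.im) : entC γ 1 0 * z + entC γ 1 1 ≠ 0 := by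
  intro h
  have him : toRealM γ 1 0 * z.im = 0 := by
    simpa [entC] using congrArg Complex.im h
  have hc : entC γ 1 0 = 0 := by
    simp [entC, (mul_eq_zero.mp him).resolve_right hz.ne']
  have hd : entC γ 1 1 = 0 := by simpa [hc] using h
  simpa [hc, hd] using entC_det γ

theorem jFac_mul_moeb (γ : SL2Z) {z : ℂ} (hz : 0 < z.im) :
    (entC γ 1 0 * z + entC γ 1 1) * moeb (toRealM γ) z = entC γ 0 0 * z + entC γ 0 1 :=
  mul_div_cancel₀ _ (jFac_ne_zero γ hz)

theorem hasDerivAt_moeb (γ : SL2Z) {z : ℂ} (hz : 0 < z.im) :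
    HasDerivAt (moeb (toRealM γ)) (1 / (entC γ 1 0 * z + entC γ 1 1) ^ 2) z := by
  have h1 : ∀ a b : ℂ, HasDerivAt (fun ζ : ℂ => a * ζ + b) a z := fun a b => by
    simpa using ((hasDerivAt_id z).const_mul a).add_const b
  refine ((h1 (entC γ 0 0) (entC γ 0 1)).fun_div (h1 (entC γ 1 0) (entC γ 1 1))
    (jFac_ne_zero γ hz)).congr_deriv ?_
  congr 1
  linear_combination entC_det γ

theorem sub_moeb_mul (γ : SL2Z) {z : ℂ} (hz : 0 < z.im) (x y : ℂ) :
    (entC γ 0 0 * x + entC γ 0 1 * y) - moeb (toRealM γ) z * (entC γ 1 0 * x + entC γ 1 1 * y) =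
      (x - z * y) / (entC γ 1 0 * z + entC γ 1 1) := by
  rw [eq_div_iff (jFac_ne_zero γ hz)]
  linear_combination (x - z * y) * entC_det γ -
    (entC γ 1 0 * x + entC γ 1 1 * y) * jFac_mul_moeb γ hz

theorem sum_form_smul (k : ℕ) (c : ℕ → ℂ) (t x y : ℂ) :
    ∑ i ∈ Finset.range (k + 1), c i * (t * x) ^ (k - i) * (t * y) ^ i =
      t ^ k * ∑ i ∈ Finset.range (k + 1), c i * x ^ (k - i) * y ^ i := by
  rw [Finset.mul_sum]
  refine Finset.sum_congr rfl fun i hi => ?_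
  have hi' : i ≤ k := Nat.lt_succ_iff.mp (Finset.mem_range.mp hi)
  rw [mul_pow, mul_pow, ← Nat.sub_add_cancel hi', pow_add t, Nat.add_sub_cancel]
  ring

theorem sum_form_diagonal (k : ℕ) (c : ℕ → ℂ) (γ : SL2Z) {z : ℂ} (hz : 0 < z.im) :
    ∑ i ∈ Finset.range (k + 1), c i * (entC γ 0 0 * z + entC γ 0 1 * 1) ^ (k - i) *
        (entC γ 1 0 * z + entC γ 1 1 * 1) ^ i =
      jFac (toRealM γ) z ^ k *
        ∑ i ∈ Finset.range (k + 1), c i * moeb (toRealM γ) z ^ (k - i) * 1 ^ i := by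
  rw [← sum_form_smul, jFac_eq, jFac_mul_moeb γ hz]
  simp only [mul_one]

/-- A homogeneous expression that vanishes at `(z, 1)` for `z` in a nonempty open set
vanishes identically. -/
theorem homogeneous_eq_zero (k : ℕ) (D : ℂ → ℂ → ℂ) (hx : ∀ y, Differentiable ℂ fun x => D x y)
    (hy : ∀ x, Continuous fun y => D x y) (hD : ∀ t x y, D (t * x) (t * y) = t ^ k * D x y)
    {U : Set ℂ} (hU : IsOpen U) (hne : U.Nonempty) (h0 : ∀ z ∈ U, D z 1 = 0) (x y : ℂ) :
    D x y = 0 := by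
  have h1 : ∀ x, D x 1 = 0 := by
    obtain ⟨z, hz⟩ := hne
    have han : AnalyticOnNhd ℂ (fun x => D x 1) Set.univ :=
      (hx 1).differentiableOn.analyticOnNhd isOpen_univ
    intro x
    exact han.eqOn_zero_of_preconnected_of_eventuallyEq_zero isPreconnected_univ
      (Set.mem_univ z) (Filter.eventually_of_mem (hU.mem_nhds hz) h0) (Set.mem_univ x)
  have h2 : ∀ y, y ≠ 0 → D x y = 0 := fun y hy0 => by
    have := hD y (x / y) 1
    rwa [mul_div_cancel₀ x hy0, mul_one, h1, mul_zero] at this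
  have h3 : (fun y => D x y) = fun _ => 0 :=
    Continuous.ext_on (dense_compl_singleton 0) (hy x) continuous_const fun y hy0 => h2 y hy0
  exact congrFun h3 y

theorem iteratedDerivWithin_diagonal {U : Set ℂ} (hU : IsOpen U) (k : ℕ) (f : ℂ → ℂ)
    (c : ℕ → ℂ → ℂ) (hc : ∀ i ≤ k, DifferentiableOn ℂ (c i) U)
    (hder : ∀ x : ℂ, ∀ z ∈ U,
      HasDerivAt (fun ζ : ℂ => ∑ i ∈ Finset.range (k + 1), c i ζ * x ^ (k - i))
        (f z * (x - z) ^ k) z) (z : ℂ) (hz : z ∈ U) :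
    iteratedDerivWithin (k + 1) (fun z => ∑ i ∈ Finset.range (k + 1), c i z * z ^ (k - i)) U z =
      k.factorial * f z := by
  open Polynomial in
  set P : ℂ → ℂ[X] := fun ζ => ∑ i ∈ Finset.range (k + 1), C (c i ζ) * X ^ (k - i) with hP
  have hcd : ∀ z ∈ U, ∀ i ∈ Finset.range (k + 1), HasDerivAt (c i) (deriv (c i) z) z :=
    fun z hz i hi => ((hc i (Nat.lt_succ_iff.mp (Finset.mem_range.mp hi))).differentiableAt
      (hU.mem_nhds hz)).hasDerivAt
  have hP' : ∀ z ∈ U, ∑ i ∈ Finset.range (k + 1), C (deriv (c i) z) * X ^ (k - i) =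
      C (f z) * (X - C z) ^ k := by
    intro z hz
    refine Polynomial.funext fun x => ?_
    have h1 : HasDerivAt (fun ζ : ℂ => ∑ i ∈ Finset.range (k + 1), c i ζ * x ^ (k - i))
        (∑ i ∈ Finset.range (k + 1), deriv (c i) z * x ^ (k - i)) z :=
      HasDerivAt.fun_sum fun i hi => (hcd z hz i hi).mul_const _
    simpa [eval_finsetSum] using h1.unique (hder x z hz)
  have hstep : ∀ m, ∀ z ∈ U, HasDerivAt (fun ζ => (derivative^[m] (P ζ)).eval ζ)
      (f z * (k.descFactorial m * (0 : ℂ) ^ (k - m)) + (derivative^[m + 1] (P z)).eval z) z := by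
    intro m z hz
    refine (hasDerivAt_eval_iterate_derivative k m c _ z (hcd z hz)).congr_deriv ?_
    rw [hP' z hz, iterate_derivative_C_mul, iterate_derivative_X_sub_pow]
    simp [hP]
  have hind : ∀ m ≤ k, ∀ z ∈ U, iteratedDerivWithin m
      (fun z => ∑ i ∈ Finset.range (k + 1), c i z * z ^ (k - i)) U z =
      (derivative^[m] (P z)).eval z := by
    intro m
    induction m with
    | zero => intro _ z _; simp [hP, eval_finsetSum]
    | succ m ih =>
      intro hm z hz
      rw [iteratedDerivWithin_succ, derivWithin_congr (ih (by lia)) (ih (by lia) z hz),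
        (hstep m z hz).hasDerivWithinAt.derivWithin (hU.uniqueDiffWithinAt hz),
        zero_pow (by lia)]
      simp
  have hdeg : derivative^[k + 1] (P z) = 0 := by
    refine iterate_derivative_eq_zero (Nat.lt_succ_of_le ?_)
    exact natDegree_sum_le_of_forall_le _ _ fun i _ =>
      (natDegree_C_mul_X_pow_le _ _).trans (Nat.sub_le k i)
  rw [iteratedDerivWithin_succ, derivWithin_congr (hind k le_rfl) (hind k le_rfl z hz),
    (hstep k z hz).hasDerivWithinAt.derivWithin (hU.uniqueDiffWithinAt hz), hdeg]
  simp [Nat.descFactorial_self, mul_comm]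

theorem hasDerivAt_iteratedDerivWithin {U : Set ℂ} (hU : IsOpen U) {h : ℂ → ℂ}
    (hh : DifferentiableOn ℂ h U) (m : ℕ) {z : ℂ} (hz : z ∈ U) :
    HasDerivAt (iteratedDerivWithin m h U) (iteratedDerivWithin (m + 1) h U z) z := by
  have hd : DifferentiableOn ℂ (iteratedDerivWithin m h U) U :=
    (hh.contDiffOn hU (n := ((m + 1 : ℕ) : WithTop ℕ∞))).differentiableOn_iteratedDerivWithin
      (by exact_mod_cast m.lt_succ_self) hU.uniqueDiffOn
  rw [iteratedDerivWithin_succ, derivWithin_of_isOpen hU hz]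
  exact (hd.differentiableAt (hU.mem_nhds hz)).hasDerivAt

/-- If the derivative of a form is `f(z)(x - zy)^k` and its diagonal values have weight `-k`
under `γ`, then the form is `γ`-equivariant. -/
theorem equivariant_of_diagonal {U : Set ℂ} (hU : IsOpen U) (hconn : IsConnected U)
    (hUH : U ⊆ {z : ℂ | 0 < z.im}) (γ : SL2Z) (hγ : ∀ z ∈ U, moeb (toRealM γ) z ∈ U)
    (k : ℕ) (f : ℂ → ℂ)
    (hmod : ∀ z ∈ U, f (moeb (toRealM γ) z) = jFac (toRealM γ) z ^ (k + 2) * f z)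
    (c : ℕ → ℂ → ℂ)
    (hder : ∀ x y : ℂ, ∀ z ∈ U,
      HasDerivAt (fun ζ : ℂ => ∑ i ∈ Finset.range (k + 1), c i ζ * x ^ (k - i) * y ^ i)
        (f z * (x - z * y) ^ k) z)
    (hdiag : ∀ z ∈ U, ∑ i ∈ Finset.range (k + 1),
        c i (moeb (toRealM γ) z) * moeb (toRealM γ) z ^ (k - i) * 1 ^ i =
      jFac (toRealM γ) z ^ (-(k : ℤ)) * ∑ i ∈ Finset.range (k + 1), c i z * z ^ (k - i) * 1 ^ i)
    (z : ℂ) (hz : z ∈ U) (x y : ℂ) :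
    ∑ i ∈ Finset.range (k + 1),
        c i (moeb (toRealM γ) z) * (entC γ 0 0 * x + entC γ 0 1 * y) ^ (k - i) *
          (entC γ 1 0 * x + entC γ 1 1 * y) ^ i =
      ∑ i ∈ Finset.range (k + 1), c i z * x ^ (k - i) * y ^ i := by
  set D : ℂ → ℂ → ℂ → ℂ := fun z x y => ∑ i ∈ Finset.range (k + 1),
        c i (moeb (toRealM γ) z) * (entC γ 0 0 * x + entC γ 0 1 * y) ^ (k - i) *
          (entC γ 1 0 * x + entC γ 1 1 * y) ^ i -
      ∑ i ∈ Finset.range (k + 1), c i z * x ^ (k - i) * y ^ i with hDdef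
  have hDder : ∀ x y, ∀ z ∈ U, HasDerivAt (fun ζ => D ζ x y) 0 z := by
    intro x y z hz
    have hzim : 0 < z.im := hUH hz
    have hj := jFac_ne_zero γ hzim
    have h1 := (hder (entC γ 0 0 * x + entC γ 0 1 * y) (entC γ 1 0 * x + entC γ 1 1 * y) _
      (hγ z hz)).comp z (hasDerivAt_moeb γ hzim)
    refine (h1.sub (hder x y z hz)).congr_deriv ?_
    rw [sub_moeb_mul γ hzim, hmod z hz, jFac_eq, div_pow, pow_add]
    field_simp
    ring
  have hconst : ∀ x y, ∀ w ∈ U, D w x y = D z x y := fun x y w hw =>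
    hU.is_const_of_deriv_eq_zero hconn.isPreconnected
      (fun v hv => (hDder x y v hv).differentiableAt.differentiableWithinAt)
      (fun v hv => (hDder x y v hv).deriv) hw hz
  refine sub_eq_zero.mp (homogeneous_eq_zero k (D z) ?_ ?_ ?_ hU hconn.nonempty ?_ x y)
  · intro y; simp only [hDdef]; fun_prop
  · intro x; simp only [hDdef]; fun_prop
  · intro t x y
    simp only [hDdef]
    rw [sum_form_smul k (fun i => c i z), mul_sub, ← sum_form_smul k (fun i => c i (moeb (toRealM γ) z))]
    congr 1
    refine Finset.sum_congr rfl fun i _ => ?_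
    congr 3 <;> ring
  · intro w hw
    rw [← hconst w 1 w hw]
    have hj : jFac (toRealM γ) w ≠ 0 := jFac_ne_zero γ (hUH hw)
    simp only [hDdef]
    rw [sum_form_diagonal k (fun i => c i (moeb (toRealM γ) w)) γ (hUH hw), hdiag w hw, zpow_neg,
      zpow_natCast, mul_inv_cancel_left₀ (pow_ne_zero k hj), sub_self]

theorem statement_2
    (Γ : Subgroup SL2Z) (𝔘 : Set ℂ) (hopen : IsOpen 𝔘) (hconn : IsConnected 𝔘)
    (hUH : 𝔘 ⊆ {z : ℂ | 0 < z.im})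
    (hinv : ∀ γ ∈ Γ, ∀ z ∈ 𝔘, moeb (toRealM γ) z ∈ 𝔘)
    (k : ℕ) (f : ℂ → ℂ) (hf : DifferentiableOn ℂ f 𝔘)
    (hmod : ∀ γ ∈ Γ, ∀ z ∈ 𝔘, f (moeb (toRealM γ) z) = jFac (toRealM γ) z ^ (k + 2) * f z) :
    (∃ c : ℕ → ℂ → ℂ,
      (∀ i ≤ k, DifferentiableOn ℂ (c i) 𝔘) ∧
      (∀ γ ∈ Γ, ∀ z ∈ 𝔘, ∀ x y : ℂ,
        ∑ i ∈ Finset.range (k + 1),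
            c i (moeb (toRealM γ) z) * (entC γ 0 0 * x + entC γ 0 1 * y) ^ (k - i) *
              (entC γ 1 0 * x + entC γ 1 1 * y) ^ i =
          ∑ i ∈ Finset.range (k + 1), c i z * x ^ (k - i) * y ^ i) ∧
      (∀ x y : ℂ, ∀ z ∈ 𝔘,
        HasDerivAt (fun ζ : ℂ => ∑ i ∈ Finset.range (k + 1), c i ζ * x ^ (k - i) * y ^ i)
          (f z * (x - z * y) ^ k) z)) ↔
    (∃ h : ℂ → ℂ, DifferentiableOn ℂ h 𝔘 ∧
      (∀ γ ∈ Γ, ∀ z ∈ 𝔘, h (moeb (toRealM γ) z) = jFac (toRealM γ) z ^ (-(k : ℤ)) * h z) ∧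
      (∀ z ∈ 𝔘, iteratedDerivWithin (k + 1) h 𝔘 z = f z)) := by
  have hfac : (k.factorial : ℂ) ≠ 0 := by exact_mod_cast k.factorial_ne_zero
  constructor
  · rintro ⟨c, hc, hequiv, hder⟩
    have hdiff : DifferentiableOn ℂ
        (fun z => ∑ i ∈ Finset.range (k + 1), c i z * z ^ (k - i)) 𝔘 :=
      DifferentiableOn.fun_sum fun i hi =>
        (hc i (Nat.lt_succ_iff.mp (Finset.mem_range.mp hi))).fun_mul (by fun_prop)
    refine ⟨fun z => (k.factorial : ℂ)⁻¹ * ∑ i ∈ Finset.range (k + 1), c i z * z ^ (k - i),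
      hdiff.const_mul _, ?_, ?_⟩
    · intro γ hγ z hz
      have hj : jFac (toRealM γ) z ≠ 0 := jFac_ne_zero γ (hUH hz)
      have h1 := hequiv γ hγ z hz z 1
      rw [sum_form_diagonal k (fun i => c i (moeb (toRealM γ) z)) γ (hUH hz)] at h1
      simp only [one_pow, mul_one] at h1
      simp only [← h1]
      rw [zpow_neg, zpow_natCast, mul_left_comm, inv_mul_cancel_left₀ (pow_ne_zero k hj)]
    · intro z hz
      rw [iteratedDerivWithin_const_mul_field, iteratedDerivWithin_diagonal hopen k f c hc
        (fun x z hz => by simpa using hder x 1 z hz) z hz, inv_mul_cancel_left₀ hfac]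
  · rintro ⟨h, hh, hhmod, hhf⟩
    set g : ℕ → ℂ → ℂ := fun m => iteratedDerivWithin m h 𝔘 with hg
    have hgd : ∀ m, ∀ z ∈ 𝔘, HasDerivAt (g m) (g (m + 1) z) z := fun m z hz =>
      hasDerivAt_iteratedDerivWithin hopen hh m hz
    set c : ℕ → ℂ → ℂ := fun i z => ∑ m ∈ Finset.range (k + 1),
      (k.factorial * (g m z / m.factorial)) * (m.choose (k - i) : ℂ) * (-z) ^ (m - (k - i)) with hc
    have hsum : ∀ x y z, ∑ i ∈ Finset.range (k + 1), c i z * x ^ (k - i) * y ^ i =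
        k.factorial * ∑ m ∈ Finset.range (k + 1),
          g m z / (m.factorial : ℂ) * (x - z * y) ^ m * y ^ (k - m) := by
      intro x y z
      simp only [hc]
      rw [sum_taylor_eq_sum_coeff k (fun m => k.factorial * (g m z / m.factorial)), Finset.mul_sum]
      simp only [mul_assoc]
    have hder : ∀ x y : ℂ, ∀ z ∈ 𝔘,
        HasDerivAt (fun ζ : ℂ => ∑ i ∈ Finset.range (k + 1), c i ζ * x ^ (k - i) * y ^ i)
          (f z * (x - z * y) ^ k) z := by
      intro x y z hz
      simp only [hsum]
      refine ((hasDerivAt_sum_taylor k g x y z fun m _ => hgd m z hz).const_mul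
        (k.factorial : ℂ)).congr_deriv ?_
      rw [show g (k + 1) z = f z from hhf z hz]
      field_simp
    have hdiag : ∀ z, ∑ i ∈ Finset.range (k + 1), c i z * z ^ (k - i) * 1 ^ i =
        k.factorial * h z := by
      intro z
      rw [hsum, Finset.sum_range_succ', Finset.sum_eq_zero]
      · simp [hg]
      · intro m _; simp
    refine ⟨c, ?_, ?_, hder⟩
    · intro i _
      refine DifferentiableOn.fun_sum fun m _ => ?_
      have : DifferentiableOn ℂ (g m) 𝔘 := fun z hz =>
        (hgd m z hz).differentiableAt.differentiableWithinAt
      fun_prop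
    · intro γ hγ z hz x y
      refine equivariant_of_diagonal hopen hconn hUH γ (hinv γ hγ) k f (hmod γ hγ) c hder ?_ z hz x y
      intro w hw
      rw [hdiag, hdiag, hhmod γ hγ w hw, mul_left_comm]
end
end

section
/- Let Γ be a finite-index subgroup of SL₂(ℤ), let n > 2 be an integer, and let P, Q ∈ ℂ[X] be polynomials with Q ≠ 0, such that Q has no real roots and deg P + n ≤ deg Q (so the rational function R = P/Q has no poles on the real axis and vanishes to order at least n at infinity). Then: (1) for every compact subset K of ℍ there exists a finite subset S ⊆ Γ such that Q(γ·z) ≠ 0 for all γ ∈ Γ∖S and z ∈ K, and the family (γ ∈ Γ∖S) ↦ sup_{z∈K} |j_γ(z)^{−n}·P(γ·z)/Q(γ·z)| is summable; (2) if z ∈ ℍ satisfies Q(γ·z) ≠ 0 for all γ ∈ Γ, then the family γ ↦ j_γ(z)^{−n}·P(γ·z)/Q(γ·z) is summable and its sum Φ(z) satisfies Φ(δ·z) = j_δ(z)^{n}·Φ(z) for every δ ∈ Γ. -/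
/- STATEMENT 3: Poincaré's convergence lemma for rational Poincaré series:
normal convergence on compact subsets of the upper half-plane, and modularity
of weight `n` of the resulting sum. -/

open Complex ComplexConjugate

noncomputable section

/-- The largest absolute value of an entry of `γ`. -/
def height (γ : SL2Z) : ℝ := max ‖γ.1 0‖ ‖γ.1 1‖

/-- The integral part of the quotient of the rows of `γ`, computed at the entry of the bottom row
of larger absolute value. -/
def rowQuotient (γ : SL2Z) : ℤ :=
  if |γ.1 1 0| ≤ |γ.1 1 1| then γ.1 0 1 / γ.1 1 1 else γ.1 0 0 / γ.1 1 0

lemma SL2Z.det_eq_one (γ : SL2Z) : γ.1 0 0 * γ.1 1 1 - γ.1 0 1 * γ.1 1 0 = 1 := by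
  rw [← Matrix.det_fin_two, γ.2]

lemma SL2Z.bottom_ne_zero (γ : SL2Z) : γ.1 1 ≠ 0 := fun h => by
  have h0 := congrFun h 0
  have h1 := congrFun h 1
  have := SL2Z.det_eq_one γ
  simp [h0, h1] at this

lemma one_le_norm_bottom (γ : SL2Z) : 1 ≤ ‖γ.1 1‖ := by
  rw [EisensteinSeries.norm_eq_max_natAbs]
  by_contra! h
  apply SL2Z.bottom_ne_zero γ
  have h' : max (γ.1 1 0).natAbs (γ.1 1 1).natAbs < 1 := by exact_mod_cast h
  ext i
  fin_cases i <;> simp <;> omega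

lemma one_le_height (γ : SL2Z) : 1 ≤ height γ :=
  (one_le_norm_bottom γ).trans (le_max_right _ _)

lemma Int.abs_ediv_mul_abs_le (b : ℤ) {d : ℤ} (hd : d ≠ 0) : |b / d| * |d| ≤ |b| + |d| := by
  have h1 := Int.emod_nonneg b hd
  have h2 := Int.emod_lt_abs b hd
  have h3 : b / d * d = b - b % d := by linarith [Int.emod_add_ediv_mul b d]
  rw [← abs_mul, h3]
  calc |b - b % d| ≤ |b| + |b % d| := abs_sub _ _
    _ ≤ |b| + |d| := by rw [abs_of_nonneg h1]; linarith

lemma rowQuotient_mul_norm_le (γ : SL2Z) :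
    (1 + |(rowQuotient γ : ℝ)|) * ‖γ.1 1‖ ≤ 3 * height γ := by
  have hb : ‖γ.1 1‖ ≤ height γ := le_max_right _ _
  have ht : ‖γ.1 0‖ ≤ height γ := le_max_left _ _
  suffices |(rowQuotient γ : ℝ)| * ‖γ.1 1‖ ≤ ‖γ.1 0‖ + ‖γ.1 1‖ by linarith
  have key (i : Fin 2) (hi : γ.1 1 i ≠ 0) (hn : ‖γ.1 1‖ = |(γ.1 1 i : ℝ)|) :
      |((γ.1 0 i / γ.1 1 i : ℤ) : ℝ)| * ‖γ.1 1‖ ≤ ‖γ.1 0‖ + ‖γ.1 1‖ := by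
    have h := Int.abs_ediv_mul_abs_le (γ.1 0 i) hi
    have h' : |((γ.1 0 i / γ.1 1 i : ℤ) : ℝ)| * |(γ.1 1 i : ℝ)|
        ≤ |(γ.1 0 i : ℝ)| + |(γ.1 1 i : ℝ)| := by exact_mod_cast h
    have h0 : |(γ.1 0 i : ℝ)| ≤ ‖γ.1 0‖ := by
      simpa [Int.norm_eq_abs] using norm_le_pi_norm (γ.1 0) i
    rw [hn]
    linarith
  have hnorm : ‖γ.1 1‖ = max |(γ.1 1 0 : ℝ)| |(γ.1 1 1 : ℝ)| := by
    rw [EisensteinSeries.norm_eq_max_natAbs]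
    simp [Nat.cast_natAbs]
  have h1 := one_le_norm_bottom γ
  unfold rowQuotient
  split_ifs with h
  · have h' : |(γ.1 1 0 : ℝ)| ≤ |(γ.1 1 1 : ℝ)| := by exact_mod_cast h
    have hn := hnorm.trans (max_eq_right h')
    refine key 1 (fun h0 => ?_) hn
    rw [hn, h0] at h1
    norm_num at h1
  · have h' : |(γ.1 1 1 : ℝ)| ≤ |(γ.1 1 0 : ℝ)| := by exact_mod_cast (not_le.1 h).le
    have hn := hnorm.trans (max_eq_left h')
    refine key 0 (fun h0 => ?_) hn
    rw [hn, h0] at h1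
    norm_num at h1

lemma injective_bottom_rowQuotient :
    Function.Injective fun γ : SL2Z => (γ.1 1, rowQuotient γ) := by
  intro γ γ' h
  obtain ⟨hr, hq⟩ := Prod.mk.inj h
  have hc : γ'.1 1 0 = γ.1 1 0 := (congrFun hr 0).symm
  have hd : γ'.1 1 1 = γ.1 1 1 := (congrFun hr 1).symm
  have e := SL2Z.det_eq_one γ
  have e' := SL2Z.det_eq_one γ'
  have hne := SL2Z.bottom_ne_zero γ
  unfold rowQuotient at hq
  rw [hc, hd] at e' hq
  obtain ⟨m, hm⟩ : ∃ m, m = γ'.1 0 0 * γ.1 0 1 - γ.1 0 0 * γ'.1 0 1 := ⟨_, rfl⟩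
  have hB : γ.1 0 1 = γ'.1 0 1 + γ.1 1 1 * m := by
    rw [hm]; linear_combination γ'.1 0 1 * e - γ.1 0 1 * e'
  have hA : γ.1 0 0 = γ'.1 0 0 + γ.1 1 0 * m := by
    rw [hm]; linear_combination γ'.1 0 0 * e - γ.1 0 0 * e'
  have hm0 : m = 0 := by
    split_ifs at hq with hle
    · have h0 : γ.1 1 1 ≠ 0 := fun h0 => by
        rw [h0, abs_zero, abs_nonpos_iff] at hle
        exact hne (by ext i; fin_cases i <;> simp [h0, hle])
      rw [hB, Int.add_mul_ediv_left _ _ h0] at hq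
      linarith
    · have h0 : γ.1 1 0 ≠ 0 := fun h0 => by
        rw [h0, abs_zero] at hle
        exact hle (abs_nonneg _)
      rw [hA, Int.add_mul_ediv_left _ _ h0] at hq
      linarith
  rw [hm0, mul_zero, add_zero] at hA hB
  ext i j
  fin_cases i <;> fin_cases j
  exacts [hA, hB, hc.symm, hd.symm]

lemma summable_int_inv_one_add_abs_pow {n : ℕ} (hn : 1 < n) :
    Summable fun k : ℤ => ((1 + |(k : ℝ)|) ^ n)⁻¹ := by
  have h := (Real.summable_one_div_int_pow (p := n)).2 hn
  refine .of_norm_bounded_eventually h.abs ?_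
  filter_upwards [(Set.finite_singleton (0 : ℤ)).compl_mem_cofinite] with k hk
  have hk0 : 0 < |(k : ℝ)| := abs_pos.2 (by exact_mod_cast hk)
  rw [Real.norm_of_nonneg (by positivity), abs_div, abs_one, abs_pow, one_div]
  gcongr
  linarith

lemma summable_height_inv_pow {n : ℕ} (hn : 2 < n) :
    Summable fun γ : SL2Z => (height γ ^ n)⁻¹ := by
  have h1 : Summable fun x : Fin 2 → ℤ => (‖x‖ ^ n)⁻¹ := by
    have := EisensteinSeries.summable_one_div_norm_rpow (k := n) (by exact_mod_cast hn)
    simpa [Real.rpow_neg, Real.rpow_natCast] using this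
  have h2 := summable_int_inv_one_add_abs_pow (n := n) (by omega)
  have h3 := (h1.mul_of_nonneg h2 (fun _ => by positivity) (fun _ => by positivity)).comp_injective
    injective_bottom_rowQuotient
  refine .of_nonneg_of_le (fun γ => ?_) (fun γ => ?_) (h3.mul_left (3 ^ n))
  · have := one_le_height γ
    positivity
  · have hh := one_le_height γ
    have hb := one_le_norm_bottom γ
    have := rowQuotient_mul_norm_le γ
    simp only [Function.comp_apply]
    rw [← mul_inv, ← mul_pow, ← inv_pow, ← inv_pow, ← mul_pow, mul_comm ‖γ.1 1‖]
    gcongr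
    rw [← div_eq_mul_inv, inv_le_comm₀ (by positivity) (by positivity), inv_div]
    linarith

lemma finite_height_le (T : ℝ) : {γ : SL2Z | height γ ≤ T}.Finite := by
  have h := (summable_height_inv_pow (n := 3) (by norm_num)).tendsto_cofinite_zero
  have h' := h.eventually_lt_const (u := ((max T 1) ^ 3)⁻¹) (by positivity)
  refine (Filter.eventually_cofinite.1 h').subset fun γ hγ => ?_
  have := one_le_height γ
  simp only [Set.mem_ofPred_eq, not_lt] at hγ ⊢
  gcongr
  exact hγ.trans (le_max_left _ _)

lemma Multiset.exists_le_norm_prod_sub (s : Multiset ℂ) (hs : ∀ ρ ∈ s, ρ.im ≠ 0) :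
    ∃ ε > (0 : ℝ), ∃ M > (0 : ℝ), ∃ C > (0 : ℝ), ∀ w : ℂ, (|w.im| ≤ ε ∨ M ≤ ‖w‖) →
      (1 + ‖w‖) ^ s.card ≤ C * ‖(s.map fun ρ => w - ρ).prod‖ := by
  induction s using Multiset.induction with
  | empty => exact ⟨1, one_pos, 1, one_pos, 1, one_pos, by simp⟩
  | cons ρ s ih =>
    obtain ⟨ε, hε, M, hM, C, hC, h⟩ := ih fun ρ' h' => hs ρ' (Multiset.mem_cons_of_mem h')
    have hρ : 0 < |ρ.im| := abs_pos.2 (hs ρ (Multiset.mem_cons_self ρ s))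
    obtain ⟨δ, hδ⟩ : ∃ δ, δ = min (|ρ.im| / 2) 1 := ⟨_, rfl⟩
    have hδ0 : 0 < δ := by rw [hδ]; positivity
    refine ⟨min ε (|ρ.im| / 2), by positivity, max M (‖ρ‖ + 1), by positivity,
      (1 + (1 + ‖ρ‖) / δ) * C, by positivity, fun w hw => ?_⟩
    have hfar : δ ≤ ‖w - ρ‖ := by
      rcases hw with hw | hw
      · have h1 : |(w - ρ).im| ≤ ‖w - ρ‖ := Complex.abs_im_le_norm _
        have h2 : |ρ.im| - |w.im| ≤ |(w - ρ).im| := by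
          rw [Complex.sub_im, abs_sub_comm]; exact abs_sub_abs_le_abs_sub _ _
        have h3 := hw.trans (min_le_right _ _)
        have h4 : δ ≤ |ρ.im| / 2 := hδ ▸ min_le_left _ _
        linarith
      · have h1 := (le_max_right _ _).trans hw
        have h2 : ‖w‖ - ‖ρ‖ ≤ ‖w - ρ‖ := norm_sub_norm_le _ _
        have h4 : δ ≤ 1 := hδ ▸ min_le_right _ _
        linarith
    have hlin : 1 + ‖w‖ ≤ (1 + (1 + ‖ρ‖) / δ) * ‖w - ρ‖ := by
      have h1 : ‖w‖ - ‖ρ‖ ≤ ‖w - ρ‖ := norm_sub_norm_le _ _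
      have h2 : 1 + ‖ρ‖ ≤ (1 + ‖ρ‖) / δ * ‖w - ρ‖ := by
        rw [div_mul_eq_mul_div, le_div_iff₀ hδ0]
        gcongr
      linarith
    have hrest := h w (hw.imp (fun h => h.trans (min_le_left _ _))
      (fun h => (le_max_left _ _).trans h))
    rw [Multiset.card_cons, Multiset.map_cons, Multiset.prod_cons, norm_mul, pow_succ]
    calc (1 + ‖w‖) ^ s.card * (1 + ‖w‖)
        ≤ (C * ‖(s.map fun ρ => w - ρ).prod‖) * ((1 + (1 + ‖ρ‖) / δ) * ‖w - ρ‖) := by gcongr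
      _ = _ := by ring

lemma Polynomial.exists_norm_eval_le (P : Polynomial ℂ) :
    ∃ C > (0 : ℝ), ∀ w : ℂ, ‖P.eval w‖ ≤ C * (1 + ‖w‖) ^ P.natDegree := by
  refine ⟨1 + ∑ i ∈ Finset.range (P.natDegree + 1), ‖P.coeff i‖, by positivity, fun w => ?_⟩
  rw [Polynomial.eval_eq_sum_range]
  refine (norm_sum_le _ _).trans ?_
  rw [add_mul, Finset.sum_mul]
  refine le_add_of_nonneg_of_le (by positivity) (Finset.sum_le_sum fun i hi => ?_)
  rw [norm_mul, norm_pow]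
  have hle : i ≤ P.natDegree := by simpa [Nat.lt_succ_iff] using hi
  gcongr
  calc ‖w‖ ^ i ≤ (1 + ‖w‖) ^ i := by gcongr; linarith
    _ ≤ _ := pow_le_pow_right₀ (by linarith [norm_nonneg w]) hle

/-- A rational function `P / Q` without real poles, vanishing to order at least `n` at infinity, is
bounded by a multiple of `(1 + ‖w‖)⁻ⁿ` near the real projective line. -/
lemma Polynomial.exists_norm_div_le {P Q : Polynomial ℂ} {n : ℕ} (hQ : Q ≠ 0)
    (hQreal : ∀ x : ℝ, Q.eval (x : ℂ) ≠ 0) (hdeg : P.natDegree + n ≤ Q.natDegree) :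
    ∃ ε > (0 : ℝ), ∃ M > (0 : ℝ), ∃ C > (0 : ℝ), ∀ w : ℂ, (|w.im| ≤ ε ∨ M ≤ ‖w‖) →
      Q.eval w ≠ 0 ∧ ‖P.eval w / Q.eval w‖ ≤ C * ((1 + ‖w‖) ^ n)⁻¹ := by
  have hroots : ∀ ρ ∈ Q.roots, ρ.im ≠ 0 := fun ρ hρ h0 => by
    apply hQreal ρ.re
    rw [show ((ρ.re : ℝ) : ℂ) = ρ from Complex.ext (by simp) (by simp [h0])]
    exact (Polynomial.mem_roots hQ).1 hρ
  obtain ⟨ε, hε, M, hM, C, hC, h⟩ := Q.roots.exists_le_norm_prod_sub hroots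
  obtain ⟨D, hD, hP⟩ := P.exists_norm_eval_le
  have hl : 0 < ‖Q.leadingCoeff‖ := norm_pos_iff.2 (Polynomial.leadingCoeff_ne_zero.2 hQ)
  have hsplit := IsAlgClosed.splits Q
  refine ⟨ε, hε, M, hM, D * (C / ‖Q.leadingCoeff‖), by positivity, fun w hw => ?_⟩
  have hw1 : 1 ≤ 1 + ‖w‖ := by linarith [norm_nonneg w]
  have hlow : (1 + ‖w‖) ^ Q.natDegree ≤ C / ‖Q.leadingCoeff‖ * ‖Q.eval w‖ := by
    rw [hsplit.eval_eq_prod_roots, hsplit.natDegree_eq_card_roots, norm_mul, ← mul_assoc,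
      div_mul_cancel₀ _ hl.ne']
    exact h w hw
  have hpos : 0 < ‖Q.eval w‖ := by
    have : 0 < C / ‖Q.leadingCoeff‖ * ‖Q.eval w‖ := lt_of_lt_of_le (by positivity) hlow
    exact pos_of_mul_pos_right this (by positivity)
  refine ⟨norm_pos_iff.1 hpos, ?_⟩
  rw [norm_div, div_le_iff₀ hpos, mul_right_comm, ← div_eq_mul_inv, le_div_iff₀ (by positivity)]
  calc ‖P.eval w‖ * (1 + ‖w‖) ^ n
      ≤ D * (1 + ‖w‖) ^ P.natDegree * (1 + ‖w‖) ^ n := by gcongr; exact hP w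
    _ = D * (1 + ‖w‖) ^ (P.natDegree + n) := by ring
    _ ≤ D * (1 + ‖w‖) ^ Q.natDegree := by gcongr
    _ ≤ D * (C / ‖Q.leadingCoeff‖ * ‖Q.eval w‖) := by gcongr
    _ = _ := by ring

lemma jFac_toRealM (γ : SL2Z) (z : ℂ) : jFac (toRealM γ) z = γ.1 1 0 * z + γ.1 1 1 := by
  simp [jFac, toRealM]

lemma moeb_toRealM (γ : SL2Z) (z : ℂ) :
    moeb (toRealM γ) z = (γ.1 0 0 * z + γ.1 0 1) / jFac (toRealM γ) z := by
  simp [jFac, moeb, toRealM]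

lemma jFac_toRealM_ne_zero (γ : SL2Z) {z : ℂ} (hz : 0 < z.im) : jFac (toRealM γ) z ≠ 0 := by
  rw [jFac_toRealM]
  exact_mod_cast UpperHalfPlane.linear_ne_zero ⟨z, hz⟩
    (cd := fun i => (γ.1 1 i : ℝ)) (fun h => SL2Z.bottom_ne_zero γ (by
      ext i; simpa using congrFun h i))

lemma im_moeb_toRealM (γ : SL2Z) (z : ℂ) :
    (moeb (toRealM γ) z).im = z.im / ‖jFac (toRealM γ) z‖ ^ 2 := by
  have h : ((γ.1 0 0 * γ.1 1 1 - γ.1 0 1 * γ.1 1 0 : ℤ) : ℝ) = 1 := by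
    rw [SL2Z.det_eq_one, Int.cast_one]
  push_cast at h
  rw [moeb_toRealM, Complex.div_im, ← Complex.normSq_eq_norm_sq, ← sub_div, jFac_toRealM]
  congr 1
  simp
  linear_combination z.im * h

lemma jFac_mul (γ δ : SL2Z) {z : ℂ} (hz : 0 < z.im) :
    jFac (toRealM (γ * δ)) z =
      jFac (toRealM γ) (moeb (toRealM δ) z) * jFac (toRealM δ) z := by
  have h := jFac_toRealM_ne_zero δ hz
  rw [jFac_toRealM γ, moeb_toRealM, add_mul, ← mul_div_assoc, div_mul_cancel₀ _ h, jFac_toRealM,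
    jFac_toRealM]
  simp [Matrix.mul_apply, Fin.sum_univ_two]
  ring

lemma moeb_mul (γ δ : SL2Z) {z : ℂ} (hz : 0 < z.im) :
    moeb (toRealM (γ * δ)) z = moeb (toRealM γ) (moeb (toRealM δ) z) := by
  have h := jFac_toRealM_ne_zero δ hz
  rw [moeb_toRealM γ, ← mul_div_mul_right _ _ h, ← jFac_mul γ δ hz, moeb_toRealM (γ * δ),
    moeb_toRealM δ, add_mul, ← mul_div_assoc, div_mul_cancel₀ _ h]
  congr 1
  rw [jFac_toRealM]
  simp [Matrix.mul_apply, Fin.sum_univ_two]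
  ring

lemma norm_row_le {y r : ℝ} (hy : 0 < y) {z : ℂ} (hyz : y ≤ z.im) (hzr : ‖z‖ ≤ r)
    (x : Fin 2 → ℤ) : ‖x‖ ≤ (1 + (1 + r) / y) * ‖(x 0 : ℂ) * z + x 1‖ := by
  have hr : 0 ≤ r := (norm_nonneg z).trans hzr
  have h0 : |(x 0 : ℝ)| * y ≤ ‖(x 0 : ℂ) * z + x 1‖ := by
    have := Complex.abs_im_le_norm ((x 0 : ℂ) * z + x 1)
    simp only [Complex.add_im, Complex.mul_im, Complex.intCast_re, Complex.intCast_im, zero_mul,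
      add_zero, abs_mul, abs_of_pos (hy.trans_le hyz)] at this
    exact le_trans (by gcongr) this
  have h0' : |(x 0 : ℝ)| ≤ ‖(x 0 : ℂ) * z + x 1‖ / y := (le_div_iff₀ hy).2 h0
  have h1 : |(x 1 : ℝ)| ≤ ‖(x 0 : ℂ) * z + x 1‖ + |(x 0 : ℝ)| * r := by
    have := norm_sub_le ((x 0 : ℂ) * z + x 1) (x 0 * z)
    rw [add_sub_cancel_left, norm_mul, Complex.norm_intCast, Complex.norm_intCast] at this
    exact this.trans (by gcongr)
  have e : (1 + (1 + r) / y) * ‖(x 0 : ℂ) * z + x 1‖ = ‖(x 0 : ℂ) * z + x 1‖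
    + ‖(x 0 : ℂ) * z + x 1‖ / y + ‖(x 0 : ℂ) * z + x 1‖ / y * r := by ring
  have h2 : |(x 0 : ℝ)| * r ≤ ‖(x 0 : ℂ) * z + x 1‖ / y * r := by gcongr
  have h3 : 0 ≤ ‖(x 0 : ℂ) * z + x 1‖ / y * r := by positivity
  have h4 : 0 ≤ ‖(x 0 : ℂ) * z + x 1‖ / y := by positivity
  have h5 := norm_nonneg ((x 0 : ℂ) * z + x 1)
  rw [pi_norm_le_iff_of_nonneg (by positivity), Fin.forall_fin_two, e, Int.norm_eq_abs,
    Int.norm_eq_abs]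
  constructor <;> linarith

lemma IsCompact.exists_im_norm_bounds {K : Set ℂ} (hK : IsCompact K)
    (hKH : K ⊆ {z : ℂ | 0 < z.im}) :
    ∃ y > (0 : ℝ), ∃ r > (0 : ℝ), ∀ z ∈ K, y ≤ z.im ∧ ‖z‖ ≤ r := by
  obtain ⟨r, hr, hKr⟩ := hK.isBounded.exists_pos_norm_le
  rcases K.eq_empty_or_nonempty with rfl | hne
  · exact ⟨1, one_pos, r, hr, by simp⟩
  · obtain ⟨z₀, hz₀, hmin⟩ := hK.exists_isMinOn hne Complex.continuous_im.continuousOn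
    exact ⟨z₀.im, hKH hz₀, r, hr, fun z hz => ⟨hmin hz, hKr z hz⟩⟩

/-- All but finitely many terms of the Poincaré series are bounded, uniformly on a compact set, by
a multiple of the corresponding power of the height. -/
lemma exists_norm_term_le {P Q : Polynomial ℂ} {n : ℕ} (hQ : Q ≠ 0)
    (hQreal : ∀ x : ℝ, Q.eval (x : ℂ) ≠ 0) (hdeg : P.natDegree + n ≤ Q.natDegree)
    {K : Set ℂ} (hK : IsCompact K) (hKH : K ⊆ {z : ℂ | 0 < z.im}) :
    ∃ T : ℝ, ∃ C > (0 : ℝ), ∀ γ : SL2Z, T < height γ → ∀ z ∈ K,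
      Q.eval (moeb (toRealM γ) z) ≠ 0 ∧
      ‖jFac (toRealM γ) z ^ (-(n : ℤ)) *
        (P.eval (moeb (toRealM γ) z) / Q.eval (moeb (toRealM γ) z))‖ ≤ C * (height γ ^ n)⁻¹ := by
  obtain ⟨ε, hε, M, hM, C, hC, h⟩ := Polynomial.exists_norm_div_le hQ hQreal hdeg
  obtain ⟨y, hy, r, hr, hyr⟩ := hK.exists_im_norm_bounds hKH
  obtain ⟨B, hB⟩ : ∃ B, B = 1 + (1 + r) / y := ⟨_, rfl⟩
  have hB0 : 0 < B := by rw [hB]; positivity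
  refine ⟨B * ((1 + M) * (r / ε + 1)), C * B ^ n, by positivity, fun γ hγ z hz => ?_⟩
  have hzim : 0 < z.im := hKH hz
  have hj : 0 < ‖jFac (toRealM γ) z‖ := norm_pos_iff.2 (jFac_toRealM_ne_zero γ hzim)
  have hj' := norm_ne_zero_iff.1 hj.ne'
  have hnum : (γ.1 0 0 : ℂ) * z + γ.1 0 1 = moeb (toRealM γ) z * jFac (toRealM γ) z := by
    rw [moeb_toRealM, div_mul_cancel₀ _ hj']
  have hheight : height γ ≤ B * ((1 + ‖moeb (toRealM γ) z‖) * ‖jFac (toRealM γ) z‖) := by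
    have hrow (i : Fin 2) := norm_row_le hy (hyr z hz).1 (hyr z hz).2 (γ.1 i)
    refine max_le ((hrow 0).trans ?_) ((hrow 1).trans ?_)
    · rw [hnum, norm_mul, ← hB]
      gcongr
      linarith
    · rw [← jFac_toRealM, ← hB]
      gcongr
      nlinarith [norm_nonneg (moeb (toRealM γ) z)]
  have hregion : |(moeb (toRealM γ) z).im| ≤ ε ∨ M ≤ ‖moeb (toRealM γ) z‖ := by
    by_contra! hcon
    obtain ⟨h1, h2⟩ := hcon
    refine hγ.not_ge (hheight.trans ?_)
    rw [im_moeb_toRealM, abs_of_pos (by positivity), lt_div_iff₀ (by positivity)] at h1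
    have h3 : z.im ≤ r := (Complex.im_le_norm z).trans (hyr z hz).2
    have h4 : ‖jFac (toRealM γ) z‖ ^ 2 ≤ r / ε := by
      rw [le_div_iff₀ hε]; linarith
    have h5 : ‖jFac (toRealM γ) z‖ ≤ r / ε + 1 := by
      nlinarith [sq_nonneg (‖jFac (toRealM γ) z‖ - 1)]
    gcongr
  obtain ⟨hQw, hbound⟩ := h _ hregion
  refine ⟨hQw, ?_⟩
  have hh := one_le_height γ
  rw [norm_mul, norm_zpow, zpow_neg, zpow_natCast]
  calc (‖jFac (toRealM γ) z‖ ^ n)⁻¹ * ‖P.eval (moeb (toRealM γ) z) / Q.eval (moeb (toRealM γ) z)‖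
      ≤ (‖jFac (toRealM γ) z‖ ^ n)⁻¹ * (C * ((1 + ‖moeb (toRealM γ) z‖) ^ n)⁻¹) := by gcongr
    _ = C * (((1 + ‖moeb (toRealM γ) z‖) * ‖jFac (toRealM γ) z‖) ^ n)⁻¹ := by
        rw [mul_pow, mul_inv]; ring
    _ ≤ C * ((height γ / B) ^ n)⁻¹ := by
        gcongr
        rwa [div_le_iff₀ hB0, mul_comm]
    _ = C * B ^ n * (height γ ^ n)⁻¹ := by
        rw [div_pow, inv_div]; ring

theorem statement_3
    (Γ : Subgroup SL2Z) (hΓ : Γ.FiniteIndex) (n : ℕ) (hn : 2 < n)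
    (P Q : Polynomial ℂ) (hQ : Q ≠ 0)
    (hQreal : ∀ x : ℝ, Q.eval (x : ℂ) ≠ 0)
    (hdeg : P.natDegree + n ≤ Q.natDegree) :
    (∀ K : Set ℂ, IsCompact K → K ⊆ {z : ℂ | 0 < z.im} →
      ∃ S : Finset Γ,
        (∀ γ : Γ, γ ∉ S → ∀ z ∈ K, Q.eval (moeb (toRealM ↑γ) z) ≠ 0) ∧
        Summable (fun γ : {γ : Γ // γ ∉ S} =>
          ⨆ z : K, ‖jFac (toRealM ↑(γ.1)) (z : ℂ) ^ (-(n : ℤ)) *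
            (P.eval (moeb (toRealM ↑(γ.1)) (z : ℂ)) /
              Q.eval (moeb (toRealM ↑(γ.1)) (z : ℂ)))‖)) ∧
    (∀ z : ℂ, 0 < z.im → (∀ γ : Γ, Q.eval (moeb (toRealM ↑γ) z) ≠ 0) →
      Summable (fun γ : Γ => jFac (toRealM ↑γ) z ^ (-(n : ℤ)) *
        (P.eval (moeb (toRealM ↑γ) z) / Q.eval (moeb (toRealM ↑γ) z))) ∧
      ∀ δ : Γ,
        (∑' γ : Γ, jFac (toRealM ↑γ) (moeb (toRealM ↑δ) z) ^ (-(n : ℤ)) *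
            (P.eval (moeb (toRealM ↑γ) (moeb (toRealM ↑δ) z)) /
              Q.eval (moeb (toRealM ↑γ) (moeb (toRealM ↑δ) z)))) =
          jFac (toRealM ↑δ) z ^ (n : ℕ) *
            ∑' γ : Γ, jFac (toRealM ↑γ) z ^ (-(n : ℤ)) *
              (P.eval (moeb (toRealM ↑γ) z) / Q.eval (moeb (toRealM ↑γ) z))) := by
  have hsum : Summable fun γ : Γ => (height γ ^ n)⁻¹ :=
    (summable_height_inv_pow hn).comp_injective Subtype.val_injective
  have hfin (T : ℝ) : {γ : Γ | height γ ≤ T}.Finite :=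
    (finite_height_le T).preimage Subtype.val_injective.injOn
  refine ⟨fun K hK hKH => ?_, fun z hz _ => ⟨?_, fun δ => ?_⟩⟩
  · obtain ⟨T, C, hC, h⟩ := exists_norm_term_le hQ hQreal hdeg hK hKH
    have hS (γ : Γ) (hγ : γ ∉ (hfin T).toFinset) : T < height γ := by simpa using hγ
    refine ⟨(hfin T).toFinset, fun γ hγ z hz => (h γ (hS γ hγ) z hz).1, ?_⟩
    refine .of_nonneg_of_le (fun γ => Real.iSup_nonneg fun _ => norm_nonneg _) (fun γ => ?_)
      ((hsum.comp_injective Subtype.val_injective).mul_left C)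
    have := one_le_height γ.1
    exact Real.iSup_le (fun z => (h γ.1 (hS γ.1 γ.2) z z.2).2)
      (by simp only [Function.comp_apply]; positivity)
  · obtain ⟨T, C, hC, h⟩ := exists_norm_term_le hQ hQreal hdeg (isCompact_singleton (x := z))
      (Set.singleton_subset_iff.2 hz)
    refine .of_norm_bounded_eventually (hsum.mul_left C) ?_
    filter_upwards [(hfin T).compl_mem_cofinite] with γ hγ
    exact (h γ (not_le.1 hγ) z rfl).2
  · rw [← (Equiv.mulRight δ).tsum_eq (fun γ : Γ => jFac (toRealM ↑γ) z ^ (-(n : ℤ)) *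
      (P.eval (moeb (toRealM ↑γ) z) / Q.eval (moeb (toRealM ↑γ) z))), ← tsum_mul_left]
    refine tsum_congr fun γ => ?_
    have hj := jFac_toRealM_ne_zero δ.1 hz
    rw [Equiv.coe_mulRight, Subgroup.coe_mul, jFac_mul _ _ hz, moeb_mul _ _ hz, mul_zpow,
      zpow_neg (jFac (toRealM δ) z), zpow_natCast]
    field_simp
end
end

section
/- Let Γ be a finite-index subgroup of SL₂(ℤ), let p, q be integers with p + q > 0, let δ be an invertible 2×2 real matrix, and let z, w ∈ ℂ∖ℝ be such that γ·(δ·z) ∉ {w, conj w} for every γ ∈ Γ. Then the family γ ↦ j_{δ⁻¹γδ}(z)^{−(p+q+2)}·ψ^{p,q}((δ⁻¹γδ)·z, δ⁻¹·w), indexed by γ ∈ Γ, is summable, and Ψ_Γ^{p,q}(δ·z, w) = j_δ(z)^{p+q+2}·(det δ)^{−(p+q+1)}·j_{δ⁻¹}(w)^{−p}·j_{δ⁻¹}(conj w)^{−q}·Σ_{γ∈Γ} j_{δ⁻¹γδ}(z)^{−(p+q+2)}·ψ^{p,q}((δ⁻¹γδ)·z, δ⁻¹·w). -/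
/- STATEMENT 7: Behaviour of the Poincaré series `Ψ_Γ^{p,q}` under the action
of an invertible real matrix `δ ∈ GL₂(ℚ)`:
`Ψ_Γ^{p,q}(δ·z, w) = j_δ(z)^{p+q+2}·(det δ)^{−(p+q+1)}·j_{δ⁻¹}(w)^{−p}·
 j_{δ⁻¹}(conj w)^{−q}·Ψ_{δ⁻¹Γδ}^{p,q}(z, δ⁻¹·w)`. -/

open Complex ComplexConjugate

noncomputable section

/-- `ψ^{p,q}(z,w) = (w − conj w)/((z − w)^(p+1)·(z − conj w)^(q+1))`. -/
def psiPQ (p q : ℤ) (z w : ℂ) : ℂ :=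
  (w - conj w) / ((z - w) ^ (p + 1) * (z - conj w) ^ (q + 1))

/-- The meromorphic Poincaré series `Ψ_Γ^{p,q}(z,w)`. -/
def PsiS (Γ : Subgroup SL2Z) (p q : ℤ) (z w : ℂ) : ℂ :=
  ∑' γ : Γ, jFac (toRealM ↑γ) z ^ (-(p + q + 2)) * psiPQ p q (moeb (toRealM ↑γ) z) w

theorem jFac_ne_zero_s7 {G : Matrix (Fin 2) (Fin 2) ℝ} (hG : G.det ≠ 0) {x : ℂ} (hx : x.im ≠ 0) :
    jFac G x ≠ 0 := by
  intro h
  rw [Matrix.det_fin_two] at hG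
  have h1 := congrArg Complex.im h
  have h2 := congrArg Complex.re h
  simp [jFac, hx] at h1 h2
  simp [h1] at h2
  simp [h1, h2] at hG

theorem moeb_eq_div (G : Matrix (Fin 2) (Fin 2) ℝ) (x : ℂ) :
    moeb G x = (((G 0 0 : ℝ) : ℂ) * x + ((G 0 1 : ℝ) : ℂ)) / jFac G x := rfl

theorem moeb_sub_moeb {G : Matrix (Fin 2) (Fin 2) ℝ} {x y : ℂ}
    (hx : jFac G x ≠ 0) (hy : jFac G y ≠ 0) :
    moeb G x - moeb G y = (G.det : ℂ) * (x - y) / (jFac G x * jFac G y) := by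
  rw [moeb_eq_div, moeb_eq_div, div_sub_div _ _ hx hy, Matrix.det_fin_two]
  congr 1
  simp only [jFac]
  push_cast
  ring

theorem conj_moeb (G : Matrix (Fin 2) (Fin 2) ℝ) (x : ℂ) :
    conj (moeb G x) = moeb G (conj x) := by
  simp [moeb]

theorem moeb_im_ne_zero {G : Matrix (Fin 2) (Fin 2) ℝ} (hG : G.det ≠ 0) {x : ℂ}
    (hx : x.im ≠ 0) : (moeb G x).im ≠ 0 := by
  have hx' : (conj x).im ≠ 0 := by simpa using hx
  rw [Ne, ← Complex.conj_eq_iff_im, conj_moeb, eq_comm, ← sub_eq_zero.not,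
    moeb_sub_moeb (jFac_ne_zero_s7 hG hx) (jFac_ne_zero_s7 hG hx')]
  have : x - conj x ≠ 0 := by
    rw [sub_ne_zero, ne_comm]
    exact Complex.conj_eq_iff_im.not.mpr hx
  exact div_ne_zero (mul_ne_zero (by exact_mod_cast hG) this)
    (mul_ne_zero (jFac_ne_zero_s7 hG hx) (jFac_ne_zero_s7 hG hx'))

theorem jFac_mul_s7 (G : Matrix (Fin 2) (Fin 2) ℝ) {H : Matrix (Fin 2) (Fin 2) ℝ} {x : ℂ}
    (hx : jFac H x ≠ 0) : jFac (G * H) x = jFac G (moeb H x) * jFac H x := by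
  have : moeb H x * jFac H x = ((H 0 0 : ℝ) : ℂ) * x + ((H 0 1 : ℝ) : ℂ) :=
    div_mul_cancel₀ _ hx
  simp only [jFac, Matrix.mul_apply, Fin.sum_univ_two] at this ⊢
  push_cast
  linear_combination (-(G 1 0 : ℂ)) * this

theorem moeb_mul_s7 {G H : Matrix (Fin 2) (Fin 2) ℝ} {x : ℂ}
    (hx : jFac H x ≠ 0) :
    moeb (G * H) x = moeb G (moeb H x) := by
  rw [moeb_eq_div, jFac_mul_s7 G hx, moeb_eq_div G, mul_comm (jFac G _), ← div_div]
  congr 1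
  have : moeb H x * jFac H x = ((H 0 0 : ℝ) : ℂ) * x + ((H 0 1 : ℝ) : ℂ) :=
    div_mul_cancel₀ _ hx
  rw [div_eq_iff hx]
  simp only [jFac, Matrix.mul_apply, Fin.sum_univ_two] at this ⊢
  push_cast
  linear_combination (-(G 0 0 : ℂ)) * this

theorem toRealM_det (γ : SL2Z) : (toRealM γ).det = 1 := by
  have h := γ.det_coe
  rw [Matrix.det_fin_two] at h ⊢
  simp only [toRealM, Matrix.map_apply]
  exact_mod_cast h

theorem psiPQ_moeb (p q : ℤ) {G : Matrix (Fin 2) (Fin 2) ℝ} (hG : G.det ≠ 0) {u w : ℂ}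
    (hu : u.im ≠ 0) (hw : w.im ≠ 0) :
    psiPQ p q (moeb G u) (moeb G w) =
      (G.det : ℂ) ^ (-(p + q + 1)) * jFac G w ^ p * jFac G (conj w) ^ q *
        jFac G u ^ (p + q + 2) * psiPQ p q u w := by
  have hw' : (conj w).im ≠ 0 := by simpa using hw
  have hju := jFac_ne_zero_s7 hG hu
  have hjw := jFac_ne_zero_s7 hG hw
  have hjw' := jFac_ne_zero_s7 hG hw'
  have hd : (G.det : ℂ) ≠ 0 := by exact_mod_cast hG
  rw [psiPQ, psiPQ, conj_moeb, moeb_sub_moeb hju hjw, moeb_sub_moeb hju hjw',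
    moeb_sub_moeb hjw hjw']
  rw [show -(p + q + 1) = 1 + -(p + 1) + -(q + 1) by ring,
    show p + q + 2 = (p + 1) + (q + 1) by ring, zpow_add₀ hju, zpow_add₀ hd, zpow_add₀ hd,
    zpow_neg, zpow_neg, zpow_one, div_zpow, div_zpow, mul_zpow, mul_zpow, mul_zpow, mul_zpow,
    zpow_add_one₀ hjw p, zpow_add_one₀ hjw' q]
  generalize (u - w) ^ (p + 1) = X, (u - conj w) ^ (q + 1) = Y
  generalize hP : jFac G u ^ (p + 1) = P
  generalize hQ : jFac G u ^ (q + 1) = Q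
  generalize (G.det : ℂ) ^ (p + 1) = D
  generalize (G.det : ℂ) ^ (q + 1) = E
  generalize hR : jFac G w ^ p = R
  generalize hS : jFac G (conj w) ^ q = S
  have hP0 : P ≠ 0 := hP ▸ zpow_ne_zero _ hju
  have hQ0 : Q ≠ 0 := hQ ▸ zpow_ne_zero _ hju
  have hR0 : R ≠ 0 := hR ▸ zpow_ne_zero _ hjw
  have hS0 : S ≠ 0 := hS ▸ zpow_ne_zero _ hjw'
  simp only [div_eq_mul_inv, mul_inv, inv_inv]
  field_simp

/-- The `ℓ¹` norm of an integral `2 × 2` matrix. -/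
def entrySum (γ : SL2Z) : ℝ :=
  |(γ 0 0 : ℝ)| + |(γ 0 1 : ℝ)| + |(γ 1 0 : ℝ)| + |(γ 1 1 : ℝ)|

theorem one_le_sq_add_sq_bottom_row (γ : SL2Z) : 1 ≤ γ 1 0 ^ 2 + γ 1 1 ^ 2 := by
  have h := γ.det_coe
  rw [Matrix.det_fin_two] at h
  by_contra! hlt
  have h0 : γ 1 0 = 0 := by nlinarith [sq_nonneg (γ 1 0), sq_nonneg (γ 1 1)]
  have h1 : γ 1 1 = 0 := by nlinarith [sq_nonneg (γ 1 0), sq_nonneg (γ 1 1)]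
  simp [h0, h1] at h

/-- The position of the top row of `γ` along the direction of its bottom row. -/
def rowShift (γ : SL2Z) : ℤ :=
  (γ 0 0 * γ 1 0 + γ 0 1 * γ 1 1) / (γ 1 0 ^ 2 + γ 1 1 ^ 2)

theorem rowShift_prod_bottomRow_injective :
    Function.Injective fun γ : SL2Z => (rowShift γ, (![γ 1 0, γ 1 1] : Fin 2 → ℤ)) := by
  intro γ γ' h
  simp only [Prod.mk.injEq] at h
  obtain ⟨hn, hv⟩ := h
  have hc : γ 1 0 = γ' 1 0 := by simpa using congrFun hv 0
  have hd : γ 1 1 = γ' 1 1 := by simpa using congrFun hv 1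
  have hpos := one_le_sq_add_sq_bottom_row γ'
  have h1 := γ.det_coe
  have h2 := γ'.det_coe
  rw [Matrix.det_fin_two] at h1 h2
  rw [rowShift, rowShift, hc, hd] at hn
  rw [hc, hd] at h1
  set m := γ 0 1 * γ' 0 0 - γ 0 0 * γ' 0 1 with hm
  have ha : γ 0 0 = γ' 0 0 + m * γ' 1 0 := by
    linear_combination γ' 0 0 * h1 - γ 0 0 * h2
  have hb : γ 0 1 = γ' 0 1 + m * γ' 1 1 := by
    linear_combination γ' 0 1 * h1 - γ 0 1 * h2
  have e : γ 0 0 * γ' 1 0 + γ 0 1 * γ' 1 1 =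
      (γ' 0 0 * γ' 1 0 + γ' 0 1 * γ' 1 1) + m * (γ' 1 0 ^ 2 + γ' 1 1 ^ 2) := by
    linear_combination γ' 1 0 * ha + γ' 1 1 * hb
  rw [e, Int.add_mul_ediv_right _ _ (by lia)] at hn
  have hm0 : m = 0 := by lia
  rw [hm0] at ha hb
  ext i j
  fin_cases i <;> fin_cases j
  · simpa using ha
  · simpa using hb
  · exact hc
  · exact hd

theorem one_add_abs_rowShift_mul_norm_le (γ : SL2Z) :
    (1 + |(rowShift γ : ℝ)|) * ‖(![γ 1 0, γ 1 1] : Fin 2 → ℤ)‖ ≤ 4 * entrySum γ := by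
  have hpos := one_le_sq_add_sq_bottom_row γ
  set v : Fin 2 → ℤ := ![γ 1 0, γ 1 1] with hv
  have hpos' : (1 : ℝ) ≤ (γ 1 0 : ℝ) ^ 2 + (γ 1 1 : ℝ) ^ 2 := by exact_mod_cast hpos
  have hc : |(γ 1 0 : ℝ)| ≤ ‖v‖ := by
    simpa [hv] using EisensteinSeries.abs_le_left_of_norm (γ 1 1) (γ 1 0)
  have hd : |(γ 1 1 : ℝ)| ≤ ‖v‖ := by
    simpa [hv] using EisensteinSeries.abs_le_right_of_norm (γ 1 1) (γ 1 0)
  have hmax : ‖v‖ = |(γ 1 0 : ℝ)| ∨ ‖v‖ = |(γ 1 1 : ℝ)| := by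
    rw [EisensteinSeries.norm_eq_max_natAbs]
    simp only [hv, Matrix.cons_val_zero, Matrix.cons_val_one, Nat.cast_max]
    rw [Nat.cast_natAbs, Nat.cast_natAbs]
    push_cast
    exact max_choice _ _
  have hle : ‖v‖ ≤ |(γ 1 0 : ℝ)| + |(γ 1 1 : ℝ)| := by
    rcases hmax with h | h <;> rw [h] <;>
      linarith [abs_nonneg (γ 1 0 : ℝ), abs_nonneg (γ 1 1 : ℝ)]
  have hsq : ‖v‖ ^ 2 ≤ (γ 1 0 : ℝ) ^ 2 + (γ 1 1 : ℝ) ^ 2 := by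
    rcases hmax with h | h <;> rw [h, sq_abs] <;> nlinarith
  have hv0 : 0 < ‖v‖ := by
    rcases (norm_nonneg v).eq_or_lt with h | h
    · rw [← h] at hc hd
      have h1 := abs_eq_zero.mp (le_antisymm hc (abs_nonneg _))
      have h2 := abs_eq_zero.mp (le_antisymm hd (abs_nonneg _))
      rw [h1, h2] at hpos'
      norm_num at hpos'
    · exact h
  have hdiv := Int.emod_add_mul_ediv (γ 0 0 * γ 1 0 + γ 0 1 * γ 1 1) (γ 1 0 ^ 2 + γ 1 1 ^ 2)
  have hr0 := Int.emod_nonneg (γ 0 0 * γ 1 0 + γ 0 1 * γ 1 1)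
    (b := γ 1 0 ^ 2 + γ 1 1 ^ 2) (by lia)
  have hr1 := Int.emod_lt_of_pos (γ 0 0 * γ 1 0 + γ 0 1 * γ 1 1)
    (b := γ 1 0 ^ 2 + γ 1 1 ^ 2) (by lia)
  change _ + _ * rowShift γ = _ at hdiv
  set r := (γ 0 0 * γ 1 0 + γ 0 1 * γ 1 1) % (γ 1 0 ^ 2 + γ 1 1 ^ 2)
  set Q : ℝ := (γ 1 0 : ℝ) ^ 2 + (γ 1 1 : ℝ) ^ 2 with hQ
  have hdiv' : (r : ℝ) + Q * rowShift γ = γ 0 0 * γ 1 0 + γ 0 1 * γ 1 1 := by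
    rw [hQ]; exact_mod_cast hdiv
  have hr0' : (0 : ℝ) ≤ r := by exact_mod_cast hr0
  have hr1' : (r : ℝ) ≤ Q := by rw [hQ]; exact_mod_cast hr1.le
  set T : ℝ := |(γ 0 0 : ℝ)| + |(γ 0 1 : ℝ)| with hT
  have hT0 : 0 ≤ T := by positivity
  have hprod : |(γ 0 0 * γ 1 0 + γ 0 1 * γ 1 1 : ℝ)| ≤ T * ‖v‖ := by
    refine (abs_add_le _ _).trans ?_
    rw [abs_mul, abs_mul, hT, add_mul]
    gcongr
  have hQn : Q * |(rowShift γ : ℝ)| ≤ T * ‖v‖ + Q := by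
    have hQ0 : 0 ≤ Q := by linarith
    rw [← abs_of_nonneg hQ0, ← abs_mul, abs_of_nonneg hQ0]
    rw [abs_le] at hprod ⊢
    constructor <;> linarith
  have hn : |(rowShift γ : ℝ)| * ‖v‖ ≤ T + ‖v‖ := by
    by_cases h1 : |(rowShift γ : ℝ)| ≤ 1
    · nlinarith
    · push Not at h1
      have : ‖v‖ ^ 2 * (|(rowShift γ : ℝ)| - 1) ≤ T * ‖v‖ := by
        nlinarith [mul_le_mul_of_nonneg_right hsq (sub_nonneg.mpr h1.le)]
      have : ‖v‖ * (|(rowShift γ : ℝ)| - 1) ≤ T := by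
        refine le_of_mul_le_mul_right ?_ hv0
        linarith
      linarith
  have : entrySum γ = T + |(γ 1 0 : ℝ)| + |(γ 1 1 : ℝ)| := rfl
  rw [this]
  linarith

theorem one_le_entrySum (γ : SL2Z) : 1 ≤ entrySum γ := by
  have h := one_le_sq_add_sq_bottom_row γ
  have : (1 : ℤ) ≤ |γ 0 0| + |γ 0 1| + |γ 1 0| + |γ 1 1| := by
    by_contra! hlt
    have h0 : γ 1 0 = 0 := by
      rw [← abs_eq_zero]
      linarith [abs_nonneg (γ 0 0), abs_nonneg (γ 0 1), abs_nonneg (γ 1 0), abs_nonneg (γ 1 1)]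
    have h1 : γ 1 1 = 0 := by
      rw [← abs_eq_zero]
      linarith [abs_nonneg (γ 0 0), abs_nonneg (γ 0 1), abs_nonneg (γ 1 0), abs_nonneg (γ 1 1)]
    simp [h0, h1] at h
  unfold entrySum
  exact_mod_cast this

theorem summable_inv_entrySum_pow_three : Summable fun γ : SL2Z => (entrySum γ ^ 3)⁻¹ := by
  have h1 : Summable fun n : ℤ => ((1 + |(n : ℝ)|) ^ 3)⁻¹ := by
    have : Summable fun n : ℤ => |1 / (n : ℝ) ^ 3| :=
      (Real.summable_one_div_int_pow.mpr (by norm_num)).abs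
    refine Summable.of_norm_bounded_eventually this ?_
    filter_upwards [(Set.finite_singleton (0 : ℤ)).compl_mem_cofinite] with n hn
    have hn : 0 < |(n : ℝ)| := by simpa using hn
    rw [norm_inv, norm_pow, Real.norm_of_nonneg (by positivity), abs_div, abs_one, abs_pow,
      one_div]
    gcongr
    linarith
  have h2 : Summable fun v : Fin 2 → ℤ => (‖v‖ ^ 3)⁻¹ := by
    refine (EisensteinSeries.summable_one_div_norm_rpow (k := 3) (by norm_num)).congr fun v => ?_
    rw [Real.rpow_neg (norm_nonneg v)]
    norm_cast
  have h3 := (h1.mul_of_nonneg h2 (fun n => by positivity) fun v => by positivity).comp_injective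
    rowShift_prod_bottomRow_injective
  refine Summable.of_nonneg_of_le (fun γ => ?_) (fun γ => ?_) (h3.mul_left (4 ^ 3))
  · have := one_le_entrySum γ
    positivity
  · have hle := one_add_abs_rowShift_mul_norm_le γ
    have hv0 : 0 < ‖(![γ 1 0, γ 1 1] : Fin 2 → ℤ)‖ := by
      rw [norm_pos_iff]
      intro hv
      have h0 : γ 1 0 = 0 := by simpa using congrFun hv 0
      have h1 : γ 1 1 = 0 := by simpa using congrFun hv 1
      have := one_le_sq_add_sq_bottom_row γ
      simp [h0, h1] at this
    have hE := one_le_entrySum γ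
    simp only [Function.comp_apply]
    rw [← mul_inv, ← mul_pow, ← div_eq_mul_inv, ← one_div, div_le_div_iff₀ (by positivity)
      (by positivity), one_mul, ← mul_pow]
    gcongr

/-- The quantity `j_γ(z)·(γ·z − w)`, as a linear form in the entries of `γ`. -/
def linForm (γ : SL2Z) (z w : ℂ) : ℂ :=
  (γ 0 0 * z + γ 0 1) - w * (γ 1 0 * z + γ 1 1)

theorem norm_linForm_le (γ : SL2Z) (z w : ℂ) :
    ‖linForm γ z w‖ ≤ (1 + ‖z‖) * (1 + ‖w‖) * entrySum γ := by
  have h (a b : ℤ) : ‖(a * z + b : ℂ)‖ ≤ (1 + ‖z‖) * (|(a : ℝ)| + |(b : ℝ)|) := by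
    refine (norm_add_le _ _).trans ?_
    rw [norm_mul, Complex.norm_intCast, Complex.norm_intCast]
    nlinarith [mul_nonneg (norm_nonneg z) (abs_nonneg (b : ℝ)), abs_nonneg (a : ℝ)]
  have h1 := h (γ 0 0) (γ 0 1)
  have h2 := h (γ 1 0) (γ 1 1)
  calc ‖linForm γ z w‖ ≤ ‖(γ 0 0 * z + γ 0 1 : ℂ)‖ + ‖w‖ * ‖(γ 1 0 * z + γ 1 1 : ℂ)‖ := by
        rw [← norm_mul]; exact norm_sub_le _ _
    _ ≤ (1 + ‖w‖) * ((1 + ‖z‖) * (|(γ 0 0 : ℝ)| + |(γ 0 1 : ℝ)|)) +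
        (1 + ‖w‖) * ((1 + ‖z‖) * (|(γ 1 0 : ℝ)| + |(γ 1 1 : ℝ)|)) := by
        gcongr
        · refine h1.trans (le_mul_of_one_le_left (by positivity) ?_)
          linarith [norm_nonneg w]
        · linarith
    _ = (1 + ‖z‖) * (1 + ‖w‖) * entrySum γ := by
        rw [entrySum]; ring

theorem abs_add_abs_le_norm_mul_add {z : ℂ} (hz : z.im ≠ 0) (a b : ℝ) :
    |a| + |b| ≤ ((1 + ‖z‖) / |z.im| + 1) * ‖(a * z + b : ℂ)‖ := by
  have hz' : 0 < |z.im| := abs_pos.mpr hz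
  have h1 : |a| ≤ ‖(a * z + b : ℂ)‖ / |z.im| := by
    rw [le_div_iff₀ hz', ← abs_mul]
    simpa using Complex.abs_im_le_norm (a * z + b : ℂ)
  have h2 : |b| ≤ ‖(a * z + b : ℂ)‖ + |a| * ‖z‖ := by
    have := norm_sub_le (a * z + b : ℂ) (a * z)
    rwa [add_sub_cancel_left, norm_mul, Complex.norm_real, Complex.norm_real, Real.norm_eq_abs,
      Real.norm_eq_abs] at this
  calc |a| + |b| ≤ |a| * (1 + ‖z‖) + ‖(a * z + b : ℂ)‖ := by linarith
    _ ≤ ‖(a * z + b : ℂ)‖ / |z.im| * (1 + ‖z‖) + ‖(a * z + b : ℂ)‖ := by gcongr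
    _ = _ := by ring

theorem exists_entrySum_le_norm_linForm_add {z w : ℂ} (hz : z.im ≠ 0) (hw : w.im ≠ 0) :
    ∃ C > 0, ∀ γ : SL2Z,
      entrySum γ ≤ C * (‖linForm γ z w‖ + ‖linForm γ z (conj w)‖) := by
  have hw0 : w - conj w ≠ 0 := by
    rw [sub_ne_zero, ne_comm]
    exact Complex.conj_eq_iff_im.not.mpr hw
  have hL : 0 < ‖w - conj w‖ := norm_pos_iff.mpr hw0
  have hK : 0 < (1 + ‖z‖) / |z.im| + 1 := by positivity
  refine ⟨((1 + ‖z‖) / |z.im| + 1) * (1 + (1 + ‖w‖) / ‖w - conj w‖), by positivity, fun γ => ?_⟩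
  have h1 := abs_add_abs_le_norm_mul_add hz (γ 0 0) (γ 0 1)
  have h2 := abs_add_abs_le_norm_mul_add hz (γ 1 0) (γ 1 1)
  simp only [Complex.ofReal_intCast] at h1 h2
  set K := (1 + ‖z‖) / |z.im| + 1
  set I : ℂ := γ 0 0 * z + γ 0 1
  set J : ℂ := γ 1 0 * z + γ 1 1
  have eA : linForm γ z w = I - w * J := rfl
  have eB : linForm γ z (conj w) = I - conj w * J := rfl
  set A := linForm γ z w
  set B := linForm γ z (conj w)
  have h3 : ‖J‖ ≤ (‖A‖ + ‖B‖) / ‖w - conj w‖ := by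
    rw [le_div_iff₀ hL, ← norm_mul, show J * (w - conj w) = B - A by rw [eA, eB]; ring, add_comm]
    exact norm_sub_le _ _
  have h4 : ‖I‖ ≤ ‖A‖ + ‖w‖ * ‖J‖ := by
    rw [← norm_mul, show I = A + w * J by rw [eA]; ring]
    exact norm_add_le _ _
  calc entrySum γ ≤ K * ‖I‖ + K * ‖J‖ := by rw [entrySum]; linarith
    _ ≤ K * (‖A‖ + ‖w‖ * ‖J‖) + K * ‖J‖ := by gcongr
    _ = K * (‖A‖ + (1 + ‖w‖) * ‖J‖) := by ring
    _ ≤ K * ((‖A‖ + ‖B‖) + (1 + ‖w‖) * ((‖A‖ + ‖B‖) / ‖w - conj w‖)) := by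
        gcongr
        linarith [norm_nonneg B]
    _ = _ := by ring

theorem norm_linForm_sq_sub_norm_linForm_conj_sq (γ : SL2Z) (z w : ℂ) :
    ‖linForm γ z w‖ ^ 2 - ‖linForm γ z (conj w)‖ ^ 2 = -4 * z.im * w.im := by
  have h := γ.det_coe
  rw [Matrix.det_fin_two] at h
  have h' : (γ 0 0 * γ 1 1 - γ 0 1 * γ 1 0 : ℝ) = 1 := by exact_mod_cast h
  rw [Complex.sq_norm, Complex.sq_norm, Complex.normSq_apply, Complex.normSq_apply]
  simp [linForm]
  linear_combination (-4 * z.im * w.im) * h'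

theorem le_mul_of_abs_sq_sub_sq_le {x y C E K : ℝ} (hx : 0 ≤ x) (hC : 0 < C) (hE : 0 < E)
    (hxy : E ≤ C * (x + y)) (hK : |x ^ 2 - y ^ 2| ≤ K) (hEK : 2 * C ^ 2 * K < E ^ 2) :
    E ≤ 4 * C * x := by
  by_contra! hlt
  have h1 : 3 * E < 4 * (C * y) := by linarith
  have h2 : (3 * E) ^ 2 < (4 * (C * y)) ^ 2 := by gcongr
  have h3 : (4 * C * x) ^ 2 < E ^ 2 := by gcongr
  have h4 := mul_le_mul_of_nonneg_left (abs_le.mp hK).1 (sq_nonneg C)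
  nlinarith

theorem zpow_le_of_mul_le_of_le_mul {m M E x : ℝ} (hm : 0 < m) (hE : 0 < E) (h1 : m * E ≤ x)
    (h2 : x ≤ M * E) (n : ℤ) : x ^ n ≤ (m ^ n + M ^ n) * E ^ n := by
  have hx : 0 < x := (mul_pos hm hE).trans_le h1
  have hM : 0 < M := pos_of_mul_pos_left (hx.trans_le h2) hE.le
  rw [add_mul, ← mul_zpow, ← mul_zpow]
  rcases le_total 0 n with hn | hn
  · have := zpow_le_zpow_left₀ hn hx.le h2
    have : 0 < (m * E) ^ n := by positivity
    linarith
  · have : x ^ n ≤ (m * E) ^ n := by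
      obtain ⟨k, rfl⟩ : ∃ k, n = -k := ⟨-n, by ring⟩
      rw [zpow_neg, zpow_neg]
      have := zpow_le_zpow_left₀ (n := k) (by lia) (by positivity) h1
      gcongr
    have : 0 < (M * E) ^ n := by positivity
    linarith

theorem eventually_entrySum_le_norm_linForm {z w : ℂ} (hz : z.im ≠ 0) (hw : w.im ≠ 0) :
    ∃ m > 0, ∀ᶠ γ : SL2Z in Filter.cofinite,
      m * entrySum γ ≤ ‖linForm γ z w‖ := by
  obtain ⟨C, hC, hE⟩ := exists_entrySum_le_norm_linForm_add hz hw
  refine ⟨1 / (4 * C), by positivity, ?_⟩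
  set K := |-4 * z.im * w.im|
  set T := 2 * C ^ 2 * K + 1 with hT
  have hT0 : 0 < T := by positivity
  have hev := summable_inv_entrySum_pow_three.tendsto_cofinite_zero.eventually_lt_const
    (show 0 < (T ^ 3)⁻¹ by positivity)
  filter_upwards [hev] with γ hγ
  have h1 := one_le_entrySum γ
  have hTE : T < entrySum γ := by
    have := (inv_lt_inv₀ (by positivity) (by positivity)).mp hγ
    exact lt_of_pow_lt_pow_left₀ 3 (by linarith) this
  rw [one_div, inv_mul_le_iff₀ (by positivity)]
  refine le_mul_of_abs_sq_sub_sq_le (norm_nonneg _) hC (by linarith) (hE γ)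
    (congrArg abs (norm_linForm_sq_sub_norm_linForm_conj_sq γ z w)).le ?_
  nlinarith

theorem jFac_zpow_mul_psiPQ_moeb (p q : ℤ) (γ : SL2Z) {z : ℂ} (hz : z.im ≠ 0) (w : ℂ) :
    jFac (toRealM γ) z ^ (-(p + q + 2)) * psiPQ p q (moeb (toRealM γ) z) w =
      (w - conj w) * (linForm γ z w ^ (-(p + 1)) * linForm γ z (conj w) ^ (-(q + 1))) := by
  have hj : jFac (toRealM γ) z ≠ 0 := jFac_ne_zero_s7 (by simp [toRealM_det]) hz
  have h (v : ℂ) : moeb (toRealM γ) z - v = linForm γ z v / jFac (toRealM γ) z := by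
    rw [moeb_eq_div, div_sub' hj, mul_comm _ v]
    simp [linForm, jFac, toRealM]
  rw [psiPQ, h, h, div_zpow, div_zpow, show -(p + q + 2) = -(p + 1) + -(q + 1) by ring,
    zpow_add₀ hj]
  simp only [zpow_neg]
  have h1 := zpow_ne_zero (p + 1) hj
  have h2 := zpow_ne_zero (q + 1) hj
  rw [div_mul_div_comm, div_div_eq_mul_div, ← mul_inv, ← mul_inv, ← div_eq_mul_inv]
  field_simp

theorem summable_psiS {p q : ℤ} (hpq : 0 < p + q) {z w : ℂ} (hz : z.im ≠ 0) (hw : w.im ≠ 0) :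
    Summable fun γ : SL2Z =>
      jFac (toRealM γ) z ^ (-(p + q + 2)) * psiPQ p q (moeb (toRealM γ) z) w := by
  obtain ⟨m₁, hm₁, h₁⟩ := eventually_entrySum_le_norm_linForm hz hw
  obtain ⟨m₂, hm₂, h₂⟩ := eventually_entrySum_le_norm_linForm hz (w := conj w) (by simpa using hw)
  set M₁ := (1 + ‖z‖) * (1 + ‖w‖)
  set M₂ := (1 + ‖z‖) * (1 + ‖conj w‖)
  set C₁ := m₁ ^ (-(p + 1)) + M₁ ^ (-(p + 1))
  set C₂ := m₂ ^ (-(q + 1)) + M₂ ^ (-(q + 1))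
  have hC₁0 : 0 ≤ C₁ := by positivity
  have hC₂0 : 0 ≤ C₂ := by positivity
  refine Summable.of_norm_bounded_eventually
    (summable_inv_entrySum_pow_three.mul_left (‖w - conj w‖ * (C₁ * C₂))) ?_
  filter_upwards [h₁, h₂] with γ hγ₁ hγ₂
  have hE := one_le_entrySum γ
  have hE0 : 0 < entrySum γ := by linarith
  rw [jFac_zpow_mul_psiPQ_moeb p q γ hz w, norm_mul, norm_mul, norm_zpow, norm_zpow, mul_assoc]
  refine mul_le_mul_of_nonneg_left ?_ (norm_nonneg _)
  calc ‖linForm γ z w‖ ^ (-(p + 1)) * ‖linForm γ z (conj w)‖ ^ (-(q + 1))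
      ≤ (C₁ * entrySum γ ^ (-(p + 1))) * (C₂ * entrySum γ ^ (-(q + 1))) := by
        gcongr
        · exact zpow_le_of_mul_le_of_le_mul hm₁ hE0 hγ₁ (norm_linForm_le γ z w) _
        · exact zpow_le_of_mul_le_of_le_mul hm₂ hE0 hγ₂ (norm_linForm_le γ z (conj w)) _
    _ = C₁ * C₂ * entrySum γ ^ (-(p + q + 2)) := by
        rw [show -(p + q + 2) = -(p + 1) + -(q + 1) by ring, zpow_add₀ hE0.ne']
        ring
    _ ≤ C₁ * C₂ * entrySum γ ^ (-3 : ℤ) := by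
        gcongr
        lia
    _ = C₁ * C₂ * (entrySum γ ^ 3)⁻¹ := by
        rw [zpow_neg]
        norm_cast

/-- Conjugating by `δ` changes each term of the Poincaré series at `δ·z` by a factor independent
of the group element. -/
theorem jFac_zpow_mul_psiPQ_conjugate (p q : ℤ) {δ G : Matrix (Fin 2) (Fin 2) ℝ}
    (hδ : δ.det ≠ 0) (hG : G.det ≠ 0) {z w : ℂ} (hz : z.im ≠ 0) (hw : w.im ≠ 0) :
    jFac G (moeb δ z) ^ (-(p + q + 2)) * psiPQ p q (moeb G (moeb δ z)) w =
      jFac δ z ^ (p + q + 2) * ((δ.det : ℝ) : ℂ) ^ (-(p + q + 1)) *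
        jFac δ⁻¹ w ^ (-p) * jFac δ⁻¹ (conj w) ^ (-q) *
        (jFac (δ⁻¹ * G * δ) z ^ (-(p + q + 2)) *
          psiPQ p q (moeb (δ⁻¹ * G * δ) z) (moeb δ⁻¹ w)) := by
  have hδ' : δ⁻¹.det ≠ 0 := by
    rw [Matrix.det_nonsing_inv, Ring.inverse_eq_inv']
    exact inv_ne_zero hδ
  have hw' : (conj w).im ≠ 0 := by simpa using hw
  have hy := moeb_im_ne_zero hδ hz
  have hu := moeb_im_ne_zero hG hy
  have hjz := jFac_ne_zero_s7 hδ hz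
  have hjy := jFac_ne_zero_s7 hG hy
  have hju := jFac_ne_zero_s7 hδ' hu
  have hjw := jFac_ne_zero_s7 hδ' hw
  have hjw' := jFac_ne_zero_s7 hδ' hw'
  have hd : (δ.det : ℂ) ≠ 0 := by exact_mod_cast hδ
  have e1 : jFac (δ⁻¹ * G * δ) z =
      jFac δ⁻¹ (moeb G (moeb δ z)) * jFac G (moeb δ z) * jFac δ z := by
    rw [jFac_mul_s7 _ hjz, jFac_mul_s7 _ hjy]
  have e2 : moeb (δ⁻¹ * G * δ) z = moeb δ⁻¹ (moeb G (moeb δ z)) := by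
    rw [moeb_mul_s7 hjz, moeb_mul_s7 hjy]
  rw [e1, e2, psiPQ_moeb p q hδ' hu hw, Matrix.det_nonsing_inv, Ring.inverse_eq_inv']
  push_cast
  rw [inv_zpow', neg_neg, mul_zpow, mul_zpow]
  simp only [zpow_neg]
  have h1 := zpow_ne_zero (p + q + 2) hjz
  have h2 := zpow_ne_zero (p + q + 1) hd
  have h3 := zpow_ne_zero p hjw
  have h4 := zpow_ne_zero q hjw'
  have h5 := zpow_ne_zero (p + q + 2) hju
  generalize jFac δ z ^ (p + q + 2) = X1 at *
  generalize (δ.det : ℂ) ^ (p + q + 1) = X2 at *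
  generalize jFac δ⁻¹ w ^ p = X3 at *
  generalize jFac δ⁻¹ (conj w) ^ q = X4 at *
  generalize jFac δ⁻¹ (moeb G (moeb δ z)) ^ (p + q + 2) = X5 at *
  field_simp

theorem statement_7
    (Γ : Subgroup SL2Z) (hΓ : Γ.FiniteIndex)
    (p q : ℤ) (hpq : 0 < p + q)
    (δ : Matrix (Fin 2) (Fin 2) ℝ) (hδ : IsUnit δ.det)
    (z w : ℂ) (hz : z.im ≠ 0) (hw : w.im ≠ 0)
    (h : ∀ γ : Γ, moeb (toRealM ↑γ) (moeb δ z) ≠ w ∧ moeb (toRealM ↑γ) (moeb δ z) ≠ conj w) :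
    Summable (fun γ : Γ =>
      jFac (δ⁻¹ * toRealM ↑γ * δ) z ^ (-(p + q + 2)) *
        psiPQ p q (moeb (δ⁻¹ * toRealM ↑γ * δ) z) (moeb δ⁻¹ w)) ∧
    PsiS Γ p q (moeb δ z) w =
      jFac δ z ^ (p + q + 2) * ((δ.det : ℝ) : ℂ) ^ (-(p + q + 1)) *
        jFac δ⁻¹ w ^ (-p) * jFac δ⁻¹ (conj w) ^ (-q) *
        ∑' γ : Γ, jFac (δ⁻¹ * toRealM ↑γ * δ) z ^ (-(p + q + 2)) *
          psiPQ p q (moeb (δ⁻¹ * toRealM ↑γ * δ) z) (moeb δ⁻¹ w) := by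
  have hδ0 : δ.det ≠ 0 := hδ.ne_zero
  have hδ' : δ⁻¹.det ≠ 0 := by
    rw [Matrix.det_nonsing_inv, Ring.inverse_eq_inv']
    exact inv_ne_zero hδ0
  have hw' : (conj w).im ≠ 0 := by simpa using hw
  have hterm (γ : Γ) := jFac_zpow_mul_psiPQ_conjugate p q hδ0
    (G := toRealM γ) (by simp [toRealM_det]) hz hw
  have hsum := (summable_psiS hpq (moeb_im_ne_zero hδ0 hz) hw).comp_injective
    (Subtype.val_injective (p := (· ∈ Γ)))
  have hc : jFac δ z ^ (p + q + 2) * ((δ.det : ℝ) : ℂ) ^ (-(p + q + 1)) *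
        jFac δ⁻¹ w ^ (-p) * jFac δ⁻¹ (conj w) ^ (-q) ≠ 0 := by
    have hd : (δ.det : ℂ) ≠ 0 := by exact_mod_cast hδ0
    exact mul_ne_zero (mul_ne_zero (mul_ne_zero (zpow_ne_zero _ (jFac_ne_zero_s7 hδ0 hz))
      (zpow_ne_zero _ hd)) (zpow_ne_zero _ (jFac_ne_zero_s7 hδ' hw)))
      (zpow_ne_zero _ (jFac_ne_zero_s7 hδ' hw'))
  refine ⟨(summable_mul_left_iff hc).mp (hsum.congr fun γ => hterm γ), ?_⟩
  rw [PsiS, ← tsum_mul_left]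
  exact tsum_congr hterm
end
end
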